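/- Let B ∈ ℂ^{n×n} be Hermitian positive definite with positive-definite square root B^{1/2}, let A ∈ ℂ^{n×n} be Hermitian positive semidefinite, and let 1 ≤ k ≤ n. Let μ₁ ≥ μ₂ ≥ ⋯ ≥ μ_n be the eigenvalues of the Hermitian matrix M = B^{-1/2} A B^{-1/2} listed in decreasing order. Then: (i) for every W ∈ ℂ^{n×k} with full column rank, tr(Wᴴ A W (Wᴴ B W)⁻¹) ≤ μ₁ + ⋯ + μ_k; and (ii) if U ∈ ℂ^{n×k} has orthonormal columns which are eigenvectors of M corresponding to the eigenvalues μ₁, …, μ_k, then for every invertible S ∈ ℂ^{k×k}, the matrix W = B^{-1/2} U S has full column rank and attains the bound: tr(Wᴴ A W (Wᴴ B W)⁻¹) = μ₁ + ⋯ + μ_k. -/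

import Mathlib

open Matrix
open scoped ComplexOrder

/-- A weighted sum of a decreasing sequence with weights in `[0, 1]` of total mass `k` is at most
the sum of the first `k` terms. -/
theorem Antitone.sum_mul_le_sum_castLE {n k : ℕ} (hk : 1 ≤ k) (hkn : k ≤ n) {μ q : Fin n → ℝ}
    (hμ : Antitone μ) (hq0 : ∀ i, 0 ≤ q i) (hq1 : ∀ i, q i ≤ 1) (hq : ∑ i, q i = k) :
    ∑ i, μ i * q i ≤ ∑ i : Fin k, μ (Fin.castLE hkn i) := by
  obtain ⟨m, rfl⟩ := Nat.exists_eq_add_of_le hkn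
  set c := μ ⟨k - 1, by omega⟩
  have hle : ∑ i, (μ i - c) * q i ≤ ∑ i : Fin k, (μ (Fin.castLE hkn i) - c) := by
    rw [Fin.sum_univ_add]
    have hfirst : ∑ i : Fin k, (μ (Fin.castAdd m i) - c) * q (Fin.castAdd m i)
        ≤ ∑ i : Fin k, (μ (Fin.castLE hkn i) - c) := by
      refine Finset.sum_le_sum fun i _ => mul_le_of_le_one_right (sub_nonneg.2 (hμ ?_)) (hq1 _)
      rw [Fin.le_def]
      simp only [Fin.val_castAdd]
      omega
    have hlast : ∑ i : Fin m, (μ (Fin.natAdd k i) - c) * q (Fin.natAdd k i) ≤ 0 := by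
      refine Finset.sum_nonpos fun i _ =>
        mul_nonpos_of_nonpos_of_nonneg (sub_nonpos.2 (hμ ?_)) (hq0 _)
      rw [Fin.le_def]
      simp only [Fin.val_natAdd]
      omega
    linarith
  simp only [sub_mul, Finset.sum_sub_distrib, ← Finset.mul_sum, hq, Finset.sum_const,
    Finset.card_univ, Fintype.card_fin, nsmul_eq_mul] at hle
  linarith

namespace Matrix

theorem IsHermitian.sq_re_diag_le_of_isIdempotentElem {ι : Type*} [Fintype ι]
    {Q : Matrix ι ι ℂ} (hQ : Q.IsHermitian) (hQQ : IsIdempotentElem Q) (i : ι) :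
    (Q i i).re ^ 2 ≤ (Q i i).re := by
  have hsum : (Q i i).re = ∑ j, Complex.normSq (Q i j) := by
    conv_lhs => rw [← hQQ.eq, mul_apply, Complex.re_sum]
    refine Finset.sum_congr rfl fun j _ => ?_
    rw [← hQ.apply j i, Complex.star_def, Complex.mul_conj, Complex.ofReal_re]
  have hle : Complex.normSq (Q i i) ≤ ∑ j, Complex.normSq (Q i j) :=
    Finset.single_le_sum (f := fun j => Complex.normSq (Q i j))
      (fun j _ => Complex.normSq_nonneg _) (Finset.mem_univ i)
  rw [Complex.normSq_apply] at hle
  nlinarith [mul_self_nonneg (Q i i).im]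

/-- Ky Fan's inequality for a diagonal matrix with decreasing real entries, in terms of the
orthogonal projection onto the column space of `Z`. -/
theorem trace_conjTranspose_mul_diagonal_mul_inv_re_le {n k : ℕ} (hk : 1 ≤ k) (hkn : k ≤ n)
    {μ : Fin n → ℝ} (hμ : Antitone μ) (Z : Matrix (Fin n) (Fin k) ℂ) (hZ : IsUnit (Zᴴ * Z)) :
    (Zᴴ * diagonal (fun i => (μ i : ℂ)) * Z * (Zᴴ * Z)⁻¹).trace.re
      ≤ ∑ i : Fin k, μ (Fin.castLE hkn i) := by
  have hdet := (isUnit_iff_isUnit_det _).1 hZ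
  set G := Zᴴ * Z with hG
  set Q := Z * G⁻¹ * Zᴴ with hQ_def
  have hQ : Q.IsHermitian := by
    have hGh : G.IsHermitian := isHermitian_conjTranspose_mul_self Z
    exact isHermitian_mul_mul_conjTranspose Z hGh.inv
  have hQQ : IsIdempotentElem Q := by
    calc Z * G⁻¹ * Zᴴ * (Z * G⁻¹ * Zᴴ) = Z * (G⁻¹ * G * G⁻¹) * Zᴴ := by
          simp only [hG, Matrix.mul_assoc]
      _ = Z * G⁻¹ * Zᴴ := by rw [nonsing_inv_mul _ hdet, Matrix.one_mul]
  have hQtr : Q.trace = k := by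
    rw [hQ_def, trace_mul_comm, ← Matrix.mul_assoc, ← hG, mul_nonsing_inv _ hdet, trace_one,
      Fintype.card_fin]
  have htr : (Zᴴ * diagonal (fun i => (μ i : ℂ)) * Z * G⁻¹).trace.re
      = ∑ i, μ i * (Q i i).re := by
    rw [show Zᴴ * diagonal (fun i => (μ i : ℂ)) * Z * G⁻¹
        = Zᴴ * (diagonal (fun i => (μ i : ℂ)) * (Z * G⁻¹)) by simp only [Matrix.mul_assoc],
      trace_mul_comm, Matrix.mul_assoc, ← hQ_def]
    simp [trace, diagonal_mul]
  have hsq := hQ.sq_re_diag_le_of_isIdempotentElem hQQ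
  rw [htr]
  refine hμ.sum_mul_le_sum_castLE hk hkn (fun i => (sq_nonneg _).trans (hsq i))
    (fun i => by nlinarith [hsq i]) ?_
  simpa [trace] using congrArg Complex.re hQtr

theorem mulVec_injective_of_mul_eq_one {m n R : Type*} [Fintype m] [Fintype n] [DecidableEq n]
    [CommSemiring R] {L : Matrix n m R} {W : Matrix m n R} (h : L * W = 1) :
    Function.Injective W.mulVec :=
  Function.LeftInverse.injective (g := L.mulVec) fun x => by simp [h]

end Matrix

/-- Proposition 2 of the paper: with `B` Hermitian positive definite (square root `Bs`),
`A` Hermitian positive semidefinite, and `μ₁ ≥ ⋯ ≥ μ_n` the eigenvalues of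
`M = Bs⁻¹ A Bs⁻¹` (unitarily diagonalized by `E`), (i) every full-column-rank `W`
satisfies `tr(Wᴴ A W (Wᴴ B W)⁻¹) ≤ μ₁ + ⋯ + μ_k`, and (ii) if the columns of `U` are
orthonormal eigenvectors of `M` for `μ₁, …, μ_k`, then for every invertible `S`,
`W = Bs⁻¹ U S` has full column rank and attains the bound. -/
theorem stmt8 {n k : ℕ} (hk : 1 ≤ k) (hkn : k ≤ n)
    (B Bs A : Matrix (Fin n) (Fin n) ℂ)
    (hB : B.PosDef) (hBs : Bs.PosDef) (hBsq : Bs * Bs = B)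
    (hA : A.PosSemidef)
    (μ : Fin n → ℝ) (hμ : Antitone μ)
    (E : Matrix (Fin n) (Fin n) ℂ) (hE : Eᴴ * E = 1)
    (hdiag : Bs⁻¹ * A * Bs⁻¹ = E * Matrix.diagonal (fun i => (μ i : ℂ)) * Eᴴ) :
    (∀ W : Matrix (Fin n) (Fin k) ℂ, IsUnit (Wᴴ * W) →
        (Wᴴ * A * W * (Wᴴ * B * W)⁻¹).trace.re
          ≤ ∑ i : Fin k, μ (Fin.castLE hkn i)) ∧
    (∀ U : Matrix (Fin n) (Fin k) ℂ, Uᴴ * U = 1 →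
      (∀ j : Fin k, (Bs⁻¹ * A * Bs⁻¹) *ᵥ (fun r => U r j)
          = (μ (Fin.castLE hkn j) : ℂ) • (fun r => U r j)) →
      ∀ S : Matrix (Fin k) (Fin k) ℂ, IsUnit S.det →
        IsUnit ((Bs⁻¹ * U * S)ᴴ * (Bs⁻¹ * U * S)) ∧
        ((Bs⁻¹ * U * S)ᴴ * A * (Bs⁻¹ * U * S) *
            ((Bs⁻¹ * U * S)ᴴ * B * (Bs⁻¹ * U * S))⁻¹).trace
          = ((∑ i : Fin k, μ (Fin.castLE hkn i) : ℝ) : ℂ)) := by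
  have hdet : IsUnit Bs.det := (isUnit_iff_isUnit_det _).1 hBs.isUnit
  have hinv : Bs⁻¹ * Bs = 1 := nonsing_inv_mul _ hdet
  have hinv' : Bs * Bs⁻¹ = 1 := mul_nonsing_inv _ hdet
  have hBsH : Bsᴴ = Bs := hBs.isHermitian
  have hBsiH : (Bs⁻¹)ᴴ = Bs⁻¹ := hBs.isHermitian.inv
  refine ⟨fun W hW => ?_, fun U hU hUM S hS => ?_⟩
  · have hEE : E * Eᴴ = 1 := mul_eq_one_comm.1 hE
    have hWinj : Function.Injective W.mulVec :=
      mulVec_injective_of_mul_eq_one (L := (Wᴴ * W)⁻¹ * Wᴴ) <| by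
        rw [Matrix.mul_assoc, nonsing_inv_mul _ ((isUnit_iff_isUnit_det _).1 hW)]
    have hGram : Wᴴ * B * W = (Eᴴ * Bs * W)ᴴ * (Eᴴ * Bs * W) := by
      calc Wᴴ * B * W = Wᴴ * Bs * (E * Eᴴ) * Bs * W := by
            simp only [hEE, ← hBsq, Matrix.mul_one, Matrix.mul_assoc]
        _ = _ := by
            simp only [conjTranspose_mul, conjTranspose_conjTranspose, hBsH, Matrix.mul_assoc]
    have hAW : Wᴴ * A * W
        = (Eᴴ * Bs * W)ᴴ * diagonal (fun i => (μ i : ℂ)) * (Eᴴ * Bs * W) := by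
      calc Wᴴ * A * W = Wᴴ * (Bs * Bs⁻¹) * A * (Bs⁻¹ * Bs) * W := by
            rw [hinv, hinv', Matrix.mul_one, Matrix.mul_one]
        _ = Wᴴ * Bs * (Bs⁻¹ * A * Bs⁻¹) * Bs * W := by simp only [Matrix.mul_assoc]
        _ = _ := by
            rw [hdiag]
            simp only [conjTranspose_mul, conjTranspose_conjTranspose, hBsH, Matrix.mul_assoc]
    have hunit : IsUnit (Wᴴ * B * W) := (hB.conjTranspose_mul_mul_same hWinj).isUnit
    rw [hGram] at hunit
    rw [hAW, hGram]
    exact trace_conjTranspose_mul_diagonal_mul_inv_re_le hk hkn hμ _ hunit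
  · have hSS : S⁻¹ * S = 1 := nonsing_inv_mul _ hS
    have hSS' : S * S⁻¹ = 1 := mul_nonsing_inv _ hS
    have hWinj : Function.Injective (Bs⁻¹ * U * S).mulVec :=
      mulVec_injective_of_mul_eq_one (L := S⁻¹ * Uᴴ * Bs) <| by
        calc S⁻¹ * Uᴴ * Bs * (Bs⁻¹ * U * S) = S⁻¹ * (Uᴴ * (Bs * Bs⁻¹) * U) * S := by
              simp only [Matrix.mul_assoc]
          _ = 1 := by rw [hinv', Matrix.mul_one, hU, Matrix.mul_one, hSS]
    refine ⟨(PosDef.conjTranspose_mul_self _ hWinj).isUnit, ?_⟩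
    set D := diagonal (fun j : Fin k => (μ (Fin.castLE hkn j) : ℂ)) with hD
    have hMU : Bs⁻¹ * A * Bs⁻¹ * U = U * D := by
      ext i j
      rw [hD, mul_diagonal, mul_comm]
      exact congrFun (hUM j) i
    have hGram : (Bs⁻¹ * U * S)ᴴ * B * (Bs⁻¹ * U * S) = Sᴴ * S := by
      calc (Bs⁻¹ * U * S)ᴴ * B * (Bs⁻¹ * U * S)
          = Sᴴ * (Uᴴ * (Bs⁻¹ * Bs) * (Bs * Bs⁻¹) * U) * S := by
            simp only [conjTranspose_mul, hBsiH, ← hBsq, Matrix.mul_assoc]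
        _ = Sᴴ * S := by rw [hinv, hinv', Matrix.mul_one, Matrix.mul_one, hU, Matrix.mul_one]
    have hAW : (Bs⁻¹ * U * S)ᴴ * A * (Bs⁻¹ * U * S) = Sᴴ * D * S := by
      calc (Bs⁻¹ * U * S)ᴴ * A * (Bs⁻¹ * U * S) = Sᴴ * Uᴴ * (Bs⁻¹ * A * Bs⁻¹ * U) * S := by
            simp only [conjTranspose_mul, hBsiH, Matrix.mul_assoc]
        _ = Sᴴ * (Uᴴ * U) * D * S := by rw [hMU]; simp only [Matrix.mul_assoc]
        _ = Sᴴ * D * S := by rw [hU, Matrix.mul_one]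
    have hSH : (Sᴴ)⁻¹ * Sᴴ = 1 := by
      rw [← conjTranspose_nonsing_inv, ← conjTranspose_mul, hSS', conjTranspose_one]
    calc _ = (Sᴴ * (D * (S * S⁻¹) * (Sᴴ)⁻¹)).trace := by
          rw [hGram, hAW, Matrix.mul_inv_rev]
          simp only [Matrix.mul_assoc]
      _ = D.trace := by
          rw [hSS', Matrix.mul_one, trace_mul_comm, Matrix.mul_assoc, hSH, Matrix.mul_one]
      _ = _ := by rw [hD, trace_diagonal, Complex.ofReal_sum]
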